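/- arXiv:1407.5055 — 2 statements merged into one kernel-verified Lean document; each statement's English description precedes it below -/
import Mathlib

section
/- Let d ≥ 1, let p ∈ ℝ^d with p ≠ 0, and let σ > 0. Then: (i) for every orthogonal matrix U ∈ ℝ^{d×d} with columns u_1,…,u_d and every λ ∈ ℝ^d, Σ_{i=1}^d [ (1 − λ_i)² (u_iᵀ p)² + σ² λ_i² ] ≥ σ² ‖p‖² / (‖p‖² + σ²); (ii) equality is attained for any orthogonal U whose first column is u_1 = p/‖p‖ together with λ = (‖p‖²/(‖p‖² + σ²), 0, …, 0). -/
open Matrix BigOperators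

theorem aux_parseval {d : ℕ} (p : Fin d → ℝ) (U : Matrix (Fin d) (Fin d) ℝ)
    (hU : Uᵀ * U = 1) : ∑ i, (∑ j, U j i * p j) ^ 2 = ∑ j, (p j) ^ 2 := by
  have hU' : U * Uᵀ = 1 := mul_eq_one_comm.mp hU
  have h1 : (Uᵀ *ᵥ p) ⬝ᵥ (Uᵀ *ᵥ p) = p ⬝ᵥ p := by
    rw [Matrix.dotProduct_mulVec, Matrix.vecMul_transpose, Matrix.mulVec_mulVec, hU',
      Matrix.one_mulVec]
  simpa [dotProduct, Matrix.mulVec, pow_two] using h1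

/-- For `p ≠ 0`: (i) for every orthogonal `U` and every `λ`,
`Σ_i [(1 − λ_i)²(u_iᵀp)² + σ²λ_i²] ≥ σ²‖p‖²/(‖p‖² + σ²)`; (ii) equality is attained for
any orthogonal `U` with first column `p/‖p‖` and `λ = (‖p‖²/(‖p‖² + σ²), 0, …, 0)`. -/
theorem stmt6 {d : ℕ} (hd : 0 < d) (p : Fin d → ℝ) (hp : p ≠ 0) (σ : ℝ) (hσ : 0 < σ) :
    (∀ U : Matrix (Fin d) (Fin d) ℝ, Uᵀ * U = 1 → ∀ lam : Fin d → ℝ,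
      σ ^ 2 * (∑ j, (p j) ^ 2) / ((∑ j, (p j) ^ 2) + σ ^ 2)
        ≤ ∑ i, ((1 - lam i) ^ 2 * (∑ j, U j i * p j) ^ 2 + σ ^ 2 * (lam i) ^ 2)) ∧
    (∀ U : Matrix (Fin d) (Fin d) ℝ, Uᵀ * U = 1 →
      (∀ j, U j ⟨0, hd⟩ = p j / Real.sqrt (∑ l, (p l) ^ 2)) →
      ∀ lam : Fin d → ℝ,
        (lam = fun i => if i = (⟨0, hd⟩ : Fin d) then
            (∑ j, (p j) ^ 2) / ((∑ j, (p j) ^ 2) + σ ^ 2) else 0) →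
        ∑ i, ((1 - lam i) ^ 2 * (∑ j, U j i * p j) ^ 2 + σ ^ 2 * (lam i) ^ 2)
          = σ ^ 2 * (∑ j, (p j) ^ 2) / ((∑ j, (p j) ^ 2) + σ ^ 2)) := by
  have hS : 0 < ∑ j, (p j) ^ 2 := by
    obtain ⟨k, hk⟩ := Function.ne_iff.mp hp
    have hk' : p k ≠ 0 := by simpa using hk
    exact Finset.sum_pos' (fun i _ => sq_nonneg _) ⟨k, Finset.mem_univ _, by positivity⟩
  refine ⟨?_, ?_⟩
  · intro U hU lam
    have hpar := aux_parseval p U hU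
    generalize hSd : ∑ j, (p j) ^ 2 = S at *
    have key : ∀ i, σ ^ 2 * (∑ j, U j i * p j) ^ 2 / (S + σ ^ 2) ≤
        (1 - lam i) ^ 2 * (∑ j, U j i * p j) ^ 2 + σ ^ 2 * (lam i) ^ 2 := by
      intro i
      have hle : (∑ j, U j i * p j) ^ 2 ≤ S := by
        rw [← hpar]
        exact Finset.single_le_sum (f := fun i => (∑ j, U j i * p j) ^ 2)
          (fun i _ => sq_nonneg _) (Finset.mem_univ i)
      have hc : 0 ≤ (∑ j, U j i * p j) ^ 2 := sq_nonneg _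
      generalize (∑ j, U j i * p j) ^ 2 = c at *
      rw [div_le_iff₀ (by positivity)]
      have h0 : 0 ≤ (1 - lam i) ^ 2 * c + σ ^ 2 * (lam i) ^ 2 := by positivity
      have h1 := mul_nonneg h0 (sub_nonneg.mpr hle)
      have h2 := sq_nonneg ((1 - lam i) * c - σ ^ 2 * lam i)
      linarith
    calc σ ^ 2 * S / (S + σ ^ 2) = ∑ i, σ ^ 2 * (∑ j, U j i * p j) ^ 2 / (S + σ ^ 2) := by
          rw [← Finset.sum_div, ← Finset.mul_sum, hpar]
      _ ≤ _ := Finset.sum_le_sum fun i _ => key i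
  · intro U hU h0 lam hlam
    have hpar := aux_parseval p U hU
    have hc0 : (∑ j, U j ⟨0, hd⟩ * p j) ^ 2 = ∑ j, (p j) ^ 2 := by
      have : ∑ j, U j ⟨0, hd⟩ * p j = (∑ j, (p j) ^ 2) / Real.sqrt (∑ l, (p l) ^ 2) := by
        rw [Finset.sum_div]
        refine Finset.sum_congr rfl fun j _ => ?_
        rw [h0 j]
        ring
      rw [this, div_pow, Real.sq_sqrt hS.le]
      field_simp
    generalize hSd : ∑ j, (p j) ^ 2 = S at *
    have key : ∀ i, (1 - lam i) ^ 2 * (∑ j, U j i * p j) ^ 2 + σ ^ 2 * (lam i) ^ 2 =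
        (∑ j, U j i * p j) ^ 2 + (if i = (⟨0, hd⟩ : Fin d) then
          ((1 - S / (S + σ ^ 2)) ^ 2 - 1) * S + σ ^ 2 * (S / (S + σ ^ 2)) ^ 2 else 0) := by
      intro i
      by_cases hi : i = (⟨0, hd⟩ : Fin d)
      · subst hi
        simp only [hlam, if_true, hc0]
        ring
      · simp [hlam, hi]
    rw [Finset.sum_congr rfl fun i _ => key i, Finset.sum_add_distrib, hpar]
    simp only [Finset.sum_ite_eq', Finset.mem_univ, if_true]
    have : S + σ ^ 2 ≠ 0 := by positivity
    field_simp
    ring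
end

section
/- Let d ≥ 1, k ≥ 1, and P ∈ ℝ^{d×k}. Let M = PPᵀ, which is a real symmetric positive semidefinite d×d matrix, and let μ_1,…,μ_d ≥ 0 be its eigenvalues (listed with multiplicity). Then: (i) for every orthogonal matrix U ∈ ℝ^{d×d} with columns u_1,…,u_d, Σ_{i=1}^d √(μ_i) ≤ Σ_{i=1}^d ‖Pᵀ u_i‖; (ii) if the columns of U form an orthonormal eigenbasis of M with M u_i = μ_i u_i for each i, then Σ_{i=1}^d ‖Pᵀ u_i‖ = Σ_{i=1}^d √(μ_i). Consequently, an orthonormal eigenbasis of PPᵀ minimizes the group-sparsity norm ‖UᵀP‖_{1,2} = Σ_{i=1}^d ‖u_iᵀ P‖₂ over all orthogonal U. -/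
open Matrix BigOperators

theorem quad_aux {d k : ℕ} (P : Matrix (Fin d) (Fin k) ℝ) (U : Matrix (Fin d) (Fin d) ℝ)
    (i : Fin d) : ∑ j, (∑ l, P l j * U l i) ^ 2 = (Uᵀ * (P * Pᵀ) * U) i i := by
  have h : Uᵀ * (P * Pᵀ) * U = (Pᵀ * U)ᵀ * (Pᵀ * U) := by
    simp [Matrix.transpose_mul, Matrix.mul_assoc]
  rw [h]
  simp only [Matrix.mul_apply, Matrix.transpose_apply, sq]

/-- Let `M = PPᵀ` with eigenvalues `μ_i ≥ 0` (realized by an orthogonal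
eigendecomposition `M = V diag(μ) Vᵀ`). Then (i) for every orthogonal `U` with columns
`u_i`, `Σ_i √(μ_i) ≤ Σ_i ‖Pᵀu_i‖`; (ii) if the columns of `U` form an orthonormal
eigenbasis with `M u_i = μ_i u_i`, then `Σ_i ‖Pᵀu_i‖ = Σ_i √(μ_i)`. Hence an orthonormal
eigenbasis of `PPᵀ` minimizes `‖UᵀP‖_{1,2}` over orthogonal `U`. -/
theorem stmt7 {d k : ℕ} (hd : 1 ≤ d) (hk : 1 ≤ k)
    (P : Matrix (Fin d) (Fin k) ℝ)
    (μ : Fin d → ℝ) (hμ : ∀ i, 0 ≤ μ i)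
    (V : Matrix (Fin d) (Fin d) ℝ) (hV : Vᵀ * V = 1)
    (hVeig : P * Pᵀ = V * Matrix.diagonal μ * Vᵀ) :
    (∀ U : Matrix (Fin d) (Fin d) ℝ, Uᵀ * U = 1 →
      ∑ i, Real.sqrt (μ i)
        ≤ ∑ i, Real.sqrt (∑ j, (∑ l, P l j * U l i) ^ 2)) ∧
    (∀ U : Matrix (Fin d) (Fin d) ℝ, Uᵀ * U = 1 →
      (∀ i, (P * Pᵀ).mulVec (fun l => U l i) = fun l => μ i * U l i) →
      ∑ i, Real.sqrt (∑ j, (∑ l, P l j * U l i) ^ 2)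
        = ∑ i, Real.sqrt (μ i)) := by
  refine ⟨fun U hU => ?_, fun U hU hE => ?_⟩
  · have hV' : V * Vᵀ = 1 := mul_eq_one_comm.mp hV
    have hU' : U * Uᵀ = 1 := mul_eq_one_comm.mp hU
    obtain ⟨W, hW⟩ : ∃ W, W = Vᵀ * U := ⟨_, rfl⟩
    have hW1 : Wᵀ * W = 1 := by
      rw [hW, Matrix.transpose_mul, Matrix.transpose_transpose, Matrix.mul_assoc,
        ← Matrix.mul_assoc V, hV', Matrix.one_mul, hU]
    have hW2 : W * Wᵀ = 1 := mul_eq_one_comm.mp hW1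
    have hcol : ∀ i, ∑ m, W m i ^ 2 = 1 := fun i => by
      have := congrFun (congrFun hW1 i) i
      simpa [Matrix.mul_apply, sq] using this
    have hrow : ∀ m, ∑ i, W m i ^ 2 = 1 := fun m => by
      have := congrFun (congrFun hW2 m) m
      simpa [Matrix.mul_apply, sq] using this
    have hq : ∀ i, ∑ j, (∑ l, P l j * U l i) ^ 2 = ∑ m, μ m * W m i ^ 2 := fun i => by
      have h : Uᵀ * (P * Pᵀ) * U = Wᵀ * (Matrix.diagonal μ * W) := by
        rw [hVeig, hW]
        simp [Matrix.transpose_mul, Matrix.mul_assoc]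
      rw [quad_aux, h, Matrix.mul_apply]
      refine Finset.sum_congr rfl fun m _ => ?_
      rw [Matrix.diagonal_mul, Matrix.transpose_apply]
      ring
    calc ∑ m, Real.sqrt (μ m) = ∑ m, ∑ i, Real.sqrt (μ m) * W m i ^ 2 := by
          refine Finset.sum_congr rfl fun m _ => ?_
          rw [← Finset.mul_sum, hrow, mul_one]
      _ = ∑ i, ∑ m, Real.sqrt (μ m) * W m i ^ 2 := Finset.sum_comm
      _ ≤ _ := by
          refine Finset.sum_le_sum fun i _ => ?_
          apply Real.le_sqrt_of_sq_le
          rw [hq]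
          have h := Finset.sum_mul_sq_le_sq_mul_sq Finset.univ
            (fun m => Real.sqrt (μ m) * W m i) (fun m => W m i)
          simp only [mul_pow, Real.sq_sqrt (hμ _), hcol, mul_one] at h
          simpa only [sq, mul_assoc] using h
  · refine Finset.sum_congr rfl fun i _ => ?_
    rw [quad_aux, Matrix.mul_assoc, Matrix.mul_apply]
    have h1 : ∀ l, (P * Pᵀ * U) l i = μ i * U l i := fun l => congrFun (hE i) l
    have h2 := congrFun (congrFun hU i) i
    rw [Matrix.mul_apply] at h2
    simp only [h1, mul_left_comm _ (μ i), ← Finset.mul_sum, h2]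
    simp
end
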